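/- Let M₁,…,M_{ℓ+1} be natural numbers and let E be a finite set of pairs (k, x) where 1 ≤ k ≤ ℓ and x = (i_{k+1},…,i_{ℓ+1}) satisfies 0 ≤ i_r ≤ M_r for k+1 ≤ r ≤ ℓ and |i_{ℓ+1}| ≤ M_{ℓ+1}; write B_{k,x} = {γ ∈ Γ : γ(k) > M_k and γ(r) = i_r for all k+1 ≤ r ≤ ℓ+1}, A₁ = {γ : γ(ℓ+1) > M_{ℓ+1}} and A₂ = {γ : γ(ℓ+1) < −M_{ℓ+1}}. Let Γ⁺ = A₁ ∪ A₂ ∪ ⋃_{(k,x)∈E} B_{k,x}, let P be the orthogonal projection of H onto the closed span of {e_γ : γ ∈ Γ⁺}, and let U be the unitary with U e_γ = e_{γ+ε_{ℓ+1}} if γ(1)=…=γ(ℓ)=0 and U e_γ = e_γ otherwise. Then the compression T : ran P → ran P, T x = P(U x), has one-dimensional kernel spanned by e_{(0,…,0,−M_{ℓ+1}−1)}, has closed range, and the orthogonal complement of its range inside ran P is spanned by e_{(0,…,0,M_{ℓ+1}+1)}. In particular T is Fredholm of index 0. -/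

import Mathlib

open scoped BigOperators InnerProductSpace

noncomputable section

/-- The index set `Γ = ℕ^ℓ × ℤ`. -/
abbrev Gamma (ℓ : ℕ) : Type := (Fin ℓ → ℕ) × ℤ

/-- The Hilbert space `H = ℓ²(Γ)`. -/
abbrev Hsp (ℓ : ℕ) := lp (fun _ : Gamma ℓ => ℂ) 2

/-- The standard orthonormal basis vector `e_γ`. -/
def e (ℓ : ℕ) (γ : Gamma ℓ) : Hsp ℓ := lp.single 2 γ 1

/-- `ε_k ∈ Γ`: the element whose `k`-th coordinate is `1` and all other coordinates are `0`
(`k` is zero-indexed: `k : Fin (ℓ+1)` corresponds to the coordinate `k+1` of the paper). -/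
def eps (ℓ : ℕ) (k : Fin (ℓ+1)) : Gamma ℓ :=
  if h : (k : ℕ) < ℓ then (Pi.single ⟨(k : ℕ), h⟩ 1, 0) else (0, 1)

/-- The `k`-th coordinate of `γ ∈ Γ`, viewed in `ℤ` (zero-indexed). -/
def coord {ℓ : ℕ} (γ : Gamma ℓ) (k : Fin (ℓ+1)) : ℤ :=
  if h : (k : ℕ) < ℓ then (γ.1 ⟨(k : ℕ), h⟩ : ℤ) else γ.2

/-- `γ(1) + … + γ(k−1)` (sum of the coordinates strictly before position `k`). -/
def sumBelow {ℓ : ℕ} (k : Fin (ℓ+1)) (γ : Gamma ℓ) : ℕ :=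
  ∑ j ∈ Finset.univ.filter (fun j : Fin ℓ => (j : ℕ) < (k : ℕ)), γ.1 j

/-- The growth condition `|d(γ+ε_k) − d(γ)| ≤ c·q^{−(γ(1)+…+γ(k−1))}` for all `γ` and `k`. -/
def GrowthCondition (ℓ : ℕ) (q c : ℝ) (d : Gamma ℓ → ℝ) : Prop :=
  ∀ (k : Fin (ℓ+1)) (γ : Gamma ℓ),
    |d (γ + eps ℓ k) - d γ| ≤ c * (q ^ sumBelow k γ)⁻¹

/-- The set `B_{k,x} = {γ : γ(k) > M_k, γ(r) = x_r for r > k}` (zero-indexed `k`). -/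
def Bset (ℓ : ℕ) (M : Fin (ℓ+1) → ℕ) (k : Fin ℓ) (x : Fin (ℓ+1) → ℤ) : Set (Gamma ℓ) :=
  {γ : Gamma ℓ | (M k.castSucc : ℤ) < (γ.1 k : ℤ) ∧
    ∀ r : Fin (ℓ+1), (k : ℕ) < (r : ℕ) → coord γ r = x r}

/-- `A₁ = {γ : γ(ℓ+1) > M_{ℓ+1}}`. -/
def A1set (ℓ : ℕ) (M : Fin (ℓ+1) → ℕ) : Set (Gamma ℓ) :=
  {γ : Gamma ℓ | (M (Fin.last ℓ) : ℤ) < γ.2}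

/-- `A₂ = {γ : γ(ℓ+1) < −M_{ℓ+1}}`. -/
def A2set (ℓ : ℕ) (M : Fin (ℓ+1) → ℕ) : Set (Gamma ℓ) :=
  {γ : Gamma ℓ | γ.2 < -(M (Fin.last ℓ) : ℤ)}

/-- The admissibility condition on the finite index set `E`:
each `(k, x) ∈ E` satisfies `0 ≤ x_r ≤ M_r` for `k < r ≤ ℓ` and `|x_{ℓ+1}| ≤ M_{ℓ+1}`. -/
def Eadm (ℓ : ℕ) (M : Fin (ℓ+1) → ℕ) (E : Finset (Fin ℓ × (Fin (ℓ+1) → ℤ))) : Prop :=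
  ∀ p ∈ E, (∀ r : Fin ℓ, (p.1 : ℕ) < (r : ℕ) →
      0 ≤ p.2 r.castSucc ∧ p.2 r.castSucc ≤ (M r.castSucc : ℤ)) ∧
    |p.2 (Fin.last ℓ)| ≤ (M (Fin.last ℓ) : ℤ)

/-- Continuous linear maps out of `ℓ²(Γ)` are determined by the basis vectors `e_γ`. -/
theorem Hsp.clm_ext {ℓ : ℕ} {F : Type*} [NormedAddCommGroup F] [NormedSpace ℂ F]
    {f g : Hsp ℓ →L[ℂ] F} (h : ∀ γ, f (e ℓ γ) = g (e ℓ γ)) : f = g := by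
  ext x
  have hx : HasSum (fun γ => lp.single 2 γ (x γ)) x := lp.hasSum_single (by norm_num) x
  have hs : ∀ γ, lp.single 2 γ (x γ) = x γ • e ℓ γ := fun γ => by
    rw [e, ← lp.single_smul, smul_eq_mul, mul_one]
  simp only [hs] at hx
  have hf := hx.mapL f
  have hg := hx.mapL g
  simp only [map_smul, h] at hf hg
  exact hf.unique hg

theorem Hsp.inner_e_left {ℓ : ℕ} (γ : Gamma ℓ) (x : Hsp ℓ) : ⟪e ℓ γ, x⟫_ℂ = x γ := by
  simp [e, lp.inner_single_left]

theorem e_apply {ℓ : ℕ} (γ δ : Gamma ℓ) : e ℓ γ δ = if δ = γ then 1 else 0 := by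
  simp [e, lp.single_apply, Pi.single_apply]

/-- A vector supported at `γ` is a multiple of `e_γ`. -/
theorem Hsp.eq_smul_e {ℓ : ℕ} {γ : Gamma ℓ} {x : Hsp ℓ} (h : ∀ δ, δ ≠ γ → x δ = 0) :
    x = x γ • e ℓ γ := by
  ext δ
  by_cases hδ : δ = γ
  · subst hδ
    simp [e_apply]
  · simp [e_apply, hδ, h δ hδ]

/-- The coordinate formula for the projection onto the closed span of `{e_γ : γ ∈ S}`. -/
theorem Hsp.proj_apply {ℓ : ℕ} {S : Set (Gamma ℓ)} [DecidablePred (· ∈ S)]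
    {P : Hsp ℓ →L[ℂ] Hsp ℓ} (hP1 : ∀ γ ∈ S, P (e ℓ γ) = e ℓ γ)
    (hP2 : ∀ γ ∉ S, P (e ℓ γ) = 0) (x : Hsp ℓ) (γ : Gamma ℓ) :
    P x γ = if γ ∈ S then x γ else 0 := by
  have key : (innerSL ℂ (e ℓ γ)).comp P = if γ ∈ S then innerSL ℂ (e ℓ γ) else 0 := by
    refine Hsp.clm_ext fun δ => ?_
    by_cases hδ : δ ∈ S <;> by_cases hγ : γ ∈ S
    · simp [hP1 δ hδ, hγ]
    · have : γ ≠ δ := fun h => hγ (h ▸ hδ)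
      simp [hP1 δ hδ, hγ, Hsp.inner_e_left, e_apply, this]
    · have : γ ≠ δ := fun h => hδ (h ▸ hγ)
      simp [hP2 δ hδ, hγ, Hsp.inner_e_left, e_apply, this]
    · simp [hP2 δ hδ, hγ]
  have := congrArg (fun f => f x) key
  by_cases hγ : γ ∈ S <;> simpa [hγ, Hsp.inner_e_left] using this

theorem add_eps_last {ℓ : ℕ} (γ : Gamma ℓ) : γ + eps ℓ (Fin.last ℓ) = (γ.1, γ.2 + 1) := by
  ext <;> simp [eps]

/-- The coordinate formula for the unitary which shifts along `{γ : γ(1) = … = γ(ℓ) = 0}`. -/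
theorem Hsp.shift_apply {ℓ : ℕ} {U : Hsp ℓ →L[ℂ] Hsp ℓ}
    (hU1 : ∀ γ : Gamma ℓ, γ.1 = 0 → U (e ℓ γ) = e ℓ (γ + eps ℓ (Fin.last ℓ)))
    (hU2 : ∀ γ : Gamma ℓ, γ.1 ≠ 0 → U (e ℓ γ) = e ℓ γ) (x : Hsp ℓ) (γ : Gamma ℓ) :
    U x γ = x (if γ.1 = 0 then (0, γ.2 - 1) else γ) := by
  have key : (innerSL ℂ (e ℓ γ)).comp U =
      innerSL ℂ (e ℓ (if γ.1 = 0 then (0, γ.2 - 1) else γ)) := by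
    refine Hsp.clm_ext fun δ => ?_
    obtain ⟨a, i⟩ := γ
    obtain ⟨b, j⟩ := δ
    simp only [ContinuousLinearMap.comp_apply, innerSL_apply_apply, Hsp.inner_e_left]
    by_cases hb : b = 0
    · rw [hU1 _ hb, add_eps_last, e_apply, e_apply]
      by_cases ha : a = 0
      · subst ha hb
        simp [sub_eq_iff_eq_add]
      · have : a ≠ b := fun h => ha (h.trans hb)
        simp [ha, this]
    · rw [hU2 _ hb, e_apply, e_apply]
      by_cases ha : a = 0
      · subst ha
        simp [Ne.symm hb]
      · simp [ha]
  have := congrArg (fun f => f x) key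
  simpa only [ContinuousLinearMap.comp_apply, innerSL_apply_apply, Hsp.inner_e_left] using this

/-- The coordinate formula for the adjoint of the shift. -/
theorem Hsp.adjoint_shift_apply {ℓ : ℕ} {U : Hsp ℓ →L[ℂ] Hsp ℓ}
    (hU1 : ∀ γ : Gamma ℓ, γ.1 = 0 → U (e ℓ γ) = e ℓ (γ + eps ℓ (Fin.last ℓ)))
    (hU2 : ∀ γ : Gamma ℓ, γ.1 ≠ 0 → U (e ℓ γ) = e ℓ γ) (x : Hsp ℓ) (γ : Gamma ℓ) :
    ContinuousLinearMap.adjoint U x γ = x (if γ.1 = 0 then (0, γ.2 + 1) else γ) := by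
  rw [← Hsp.inner_e_left, ContinuousLinearMap.adjoint_inner_right]
  by_cases hγ : γ.1 = 0
  · rw [hU1 γ hγ, Hsp.inner_e_left, add_eps_last, if_pos hγ, hγ]
  · rw [hU2 γ hγ, Hsp.inner_e_left, if_neg hγ]

/-- On the line `{(0, j)}`, membership in `Γ⁺` only depends on `A₁` and `A₂`. -/
theorem zero_mk_mem_iff {ℓ : ℕ} (M : Fin (ℓ+1) → ℕ)
    (E : Finset (Fin ℓ × (Fin (ℓ+1) → ℤ))) (j : ℤ) :
    ((0, j) : Gamma ℓ) ∈ A1set ℓ M ∪ A2set ℓ M ∪ ⋃ p ∈ E, Bset ℓ M p.1 p.2 ↔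
      (M (Fin.last ℓ) : ℤ) < j ∨ j < -(M (Fin.last ℓ) : ℤ) := by
  have hB : ((0, j) : Gamma ℓ) ∉ ⋃ p ∈ E, Bset ℓ M p.1 p.2 := by
    simp only [Set.mem_iUnion, not_exists]
    rintro p - ⟨h, -⟩
    simp only [Pi.zero_apply, Nat.cast_zero] at h
    omega
  simp only [Set.mem_union, hB, or_false]
  rfl

/-- for `Γ⁺ = A₁ ∪ A₂ ∪ ⋃_{(k,x)∈E} B_{k,x}`, the compression `T = PUP`
of the unitary `U` to `ran P` has one-dimensional kernel spanned by
`e_{(0,…,0,−M_{ℓ+1}−1)}`, has closed range, and the orthogonal complement of its range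
inside `ran P` is spanned by `e_{(0,…,0,M_{ℓ+1}+1)}`; in particular `T` is Fredholm of
index `0`. -/
theorem stmt13 (ℓ : ℕ) (hℓ : 1 ≤ ℓ) (M : Fin (ℓ+1) → ℕ)
    (E : Finset (Fin ℓ × (Fin (ℓ+1) → ℤ))) (hE : Eadm ℓ M E)
    (U P : Hsp ℓ →L[ℂ] Hsp ℓ)
    (hU1 : ∀ γ : Gamma ℓ, γ.1 = 0 → U (e ℓ γ) = e ℓ (γ + eps ℓ (Fin.last ℓ)))
    (hU2 : ∀ γ : Gamma ℓ, γ.1 ≠ 0 → U (e ℓ γ) = e ℓ γ)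
    (hP1 : ∀ γ ∈ A1set ℓ M ∪ A2set ℓ M ∪ ⋃ p ∈ E, Bset ℓ M p.1 p.2,
      P (e ℓ γ) = e ℓ γ)
    (hP2 : ∀ γ ∉ A1set ℓ M ∪ A2set ℓ M ∪ ⋃ p ∈ E, Bset ℓ M p.1 p.2,
      P (e ℓ γ) = 0) :
    (∀ x : Hsp ℓ, P x = x →
      (P (U x) = 0 ↔ ∃ c : ℂ, x = c • e ℓ (0, -(M (Fin.last ℓ) : ℤ) - 1))) ∧
    IsClosed {y : Hsp ℓ | ∃ x : Hsp ℓ, P x = x ∧ y = P (U x)} ∧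
    (∀ y : Hsp ℓ, P y = y →
      ((∀ x : Hsp ℓ, P x = x → ⟪P (U x), y⟫_ℂ = 0) ↔
        ∃ c : ℂ, y = c • e ℓ (0, (M (Fin.last ℓ) : ℤ) + 1))) := by
  classical
  have hS := zero_mk_mem_iff M E
  set S : Set (Gamma ℓ) := A1set ℓ M ∪ A2set ℓ M ∪ ⋃ p ∈ E, Bset ℓ M p.1 p.2
  set m : ℤ := (M (Fin.last ℓ) : ℤ)
  have hm : 0 ≤ m := Int.natCast_nonneg _
  have hP := Hsp.proj_apply hP1 hP2
  have hU := Hsp.shift_apply hU1 hU2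
  have hV := Hsp.adjoint_shift_apply hU1 hU2
  have hfix : ∀ x : Hsp ℓ, P x = x → ∀ γ ∉ S, x γ = 0 := fun x hx γ hγ => by
    rw [← hx, hP, if_neg hγ]
  have hT0 : ∀ x : Hsp ℓ, P x = x → P (U x) (0, m + 1) = 0 := fun x hx => by
    have h0 : x (0, m) = 0 := hfix x hx _ (by rw [hS]; omega)
    rw [hP, hU, if_pos rfl, add_sub_cancel_right, h0, ite_self]
  refine ⟨fun x hx => ⟨fun h => ⟨_, Hsp.eq_smul_e fun γ hγ => ?_⟩, ?_⟩, ?_, fun y hy =>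
    ⟨fun h => ⟨_, Hsp.eq_smul_e fun γ hγ => ?_⟩, ?_⟩⟩
  · by_cases hγS : γ ∈ S
    · have hTx : ∀ δ ∈ S, x (if δ.1 = 0 then (0, δ.2 - 1) else δ) = 0 := fun δ hδ => by
        rw [← hU, ← if_pos (c := δ ∈ S) (t := U x δ) (e := 0) hδ, ← hP, h]
        rfl
      obtain ⟨a, j⟩ := γ
      by_cases ha : a = 0
      · subst ha
        have hj : j ≠ -m - 1 := fun h => hγ (by rw [h])
        rw [hS] at hγS
        simpa using hTx (0, j + 1) (by rw [hS]; omega)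
      · simpa [ha] using hTx _ hγS
    · exact hfix x hx γ hγS
  · rintro ⟨c, rfl⟩
    rw [map_smul, hU1 _ rfl, map_smul, add_eps_last, hP2, smul_zero]
    rw [hS]
    dsimp only
    omega
  · have hrange : {y : Hsp ℓ | ∃ x : Hsp ℓ, P x = x ∧ y = P (U x)} =
        {y | P y = y} ∩ {y | ⟪e ℓ (0, m + 1), y⟫_ℂ = 0} := by
      have hPP : ∀ x, P (P x) = P x := fun x => by
        ext γ
        simp only [hP]
        split_ifs <;> rfl
      ext y
      simp only [Set.mem_inter_iff, Set.mem_ofPred_eq, Hsp.inner_e_left]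
      refine ⟨?_, fun ⟨hy, hy0⟩ => ⟨P (ContinuousLinearMap.adjoint U y), hPP _, ?_⟩⟩
      · rintro ⟨x, hx, rfl⟩
        exact ⟨hPP _, hT0 x hx⟩
      · ext γ
        rw [hP, hU, hP, hV]
        by_cases hγS : γ ∈ S
        · obtain ⟨a, j⟩ := γ
          by_cases ha : a = 0
          · subst ha
            by_cases hj : ((0, j - 1) : Gamma ℓ) ∈ S
            · simp [hγS, hj]
            · simp only [if_true, hγS, hj, if_false]
              rw [hS] at hγS hj
              rw [show j = m + 1 by omega, hy0]
          · simp [ha, hγS]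
        · rw [if_neg hγS, hfix y hy γ hγS]
    rw [hrange]
    exact (isClosed_eq P.continuous continuous_id).inter
      (isClosed_eq (continuous_const.inner continuous_id) continuous_const)
  · by_cases hγS : γ ∈ S
    · obtain ⟨a, j⟩ := γ
      by_cases ha : a = 0
      · subst ha
        have hj : j ≠ m + 1 := fun h => hγ (by rw [h])
        have hj' := h (e ℓ (0, j - 1)) (hP1 _ (by rw [hS] at hγS ⊢; omega))
        rwa [hU1 _ rfl, add_eps_last, sub_add_cancel, hP1 _ hγS, Hsp.inner_e_left] at hj'
      · have ha' := h (e ℓ (a, j)) (hP1 _ hγS)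
        rwa [hU2 _ ha, hP1 _ hγS, Hsp.inner_e_left] at ha'
    · exact hfix y hy γ hγS
  · rintro ⟨c, rfl⟩ x hx
    rw [inner_smul_right, ← inner_conj_symm, Hsp.inner_e_left, hT0 x hx, map_zero, mul_zero]
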